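/- arXiv:1812.10460 — 5 statements merged into one kernel-verified Lean document; each statement's English description precedes it below -/
import Mathlib

section
/- Unbiasedness of the count-sketch estimator (first part of Theorem 1): for every index i ∈ Fin n, the expectation of the count-sketch estimator satisfies E[c_i] = a_i. -/
open MeasureTheory ProbabilityTheory
open scoped ENNReal

/-- A random sign taking the value `1` with probability `1 / 2` has mean zero. -/
theorem integral_eq_zero_of_sign {Ω : Type*} [MeasurableSpace Ω] (P : Measure Ω)
    [IsProbabilityMeasure P] {X : Ω → ℝ} (hX : Measurable X)
    (hval : ∀ ω, X ω = 1 ∨ X ω = -1) (hunif : P {ω | X ω = 1} = 1 / 2) :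
    ∫ ω, X ω ∂P = 0 := by
  have hA : MeasurableSet {ω | X ω = 1} := hX (measurableSet_singleton 1)
  have hX_eq : X = fun ω => 2 * {ω | X ω = 1}.indicator 1 ω - 1 := by
    funext ω
    rcases hval ω with hω | hω <;> norm_num [Set.indicator, hω]
  have hint : Integrable ({ω | X ω = 1}.indicator (1 : Ω → ℝ)) P :=
    (integrable_const (1 : ℝ)).indicator hA
  calc ∫ ω, X ω ∂P = ∫ ω, (2 * {ω | X ω = 1}.indicator 1 ω - 1) ∂P :=
        congrArg (fun f : Ω → ℝ => ∫ ω, f ω ∂P) hX_eq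
    _ = 0 := by
        rw [integral_sub (hint.const_mul 2) (integrable_const 1), integral_const_mul,
          integral_indicator_one hA]
        simp [Measure.real, hunif]

/-- Unbiasedness of the count-sketch estimator (first part of Theorem 1):
for every index `i : Fin n`, `E[c i] = a i`, where
`c i ω = s ω i * ∑_{j : h ω j = h ω i} s ω j * a j`. -/
theorem countSketch_unbiased
    {Ω : Type*} [MeasurableSpace Ω] (P : Measure Ω) [IsProbabilityMeasure P]
    {n b : ℕ} (hn : 1 ≤ n) (hb : 1 ≤ b) (a : Fin n → ℝ)
    (h : Ω → Fin n → Fin b) (s : Ω → Fin n → ℝ)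
    (hhm : Measurable h) (hsm : Measurable s)
    (hsval : ∀ ω i, s ω i = 1 ∨ s ω i = -1)
    (hhunif : ∀ (i : Fin n) (x : Fin b), P {ω | h ω i = x} = 1 / (b : ℝ≥0∞))
    (hhpair : ∀ i j : Fin n, i ≠ j → IndepFun (fun ω => h ω i) (fun ω => h ω j) P)
    (hsunif : ∀ i : Fin n, P {ω | s ω i = 1} = 1 / 2)
    (hspair : ∀ i j : Fin n, i ≠ j → IndepFun (fun ω => s ω i) (fun ω => s ω j) P)
    (hhs : IndepFun h s P)
    (c : Fin n → Ω → ℝ)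
    (hc : ∀ i ω, c i ω =
      s ω i * ∑ j ∈ Finset.univ.filter (fun j => h ω j = h ω i), s ω j * a j)
    (i : Fin n) :
    ∫ ω, c i ω ∂P = a i := by
  have hs_meas (j : Fin n) : Measurable fun ω => s ω j := (measurable_pi_apply j).comp hsm
  let g (j : Fin n) (x : Fin n → Fin b) : ℝ := if x j = x i then 1 else 0
  have hg (j : Fin n) : Measurable (g j) :=
    Measurable.ite (measurableSet_eq_fun (measurable_pi_apply j) (measurable_pi_apply i))
      measurable_const measurable_const
  let q (j : Fin n) (y : Fin n → ℝ) : ℝ := y i * y j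
  have hq (j : Fin n) : Measurable (q j) :=
    (measurable_pi_apply i).mul (measurable_pi_apply j)
  have hc_sum (ω : Ω) : c i ω = ∑ j, g j (h ω) * q j (s ω) * a j := by
    rw [hc, Finset.sum_filter, Finset.mul_sum]
    refine Finset.sum_congr rfl fun j _ => ?_
    by_cases hj : h ω j = h ω i <;> simp [g, q, hj, mul_assoc]
  have hint (j : Fin n) : Integrable (fun ω => g j (h ω) * q j (s ω) * a j) P := by
    refine Integrable.mul_const (Integrable.of_bound
      (((hg j).comp hhm).mul ((hq j).comp hsm)).aestronglyMeasurable 1 ?_) _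
    refine Filter.Eventually.of_forall fun ω => ?_
    rcases hsval ω i with hi | hi <;> rcases hsval ω j with hj | hj <;>
      by_cases hij : h ω j = h ω i <;> simp [g, q, hi, hj, hij]
  simp_rw [hc_sum]
  rw [integral_finsetSum _ fun j _ => hint j, Finset.sum_eq_single i]
  · have hone (ω : Ω) : g i (h ω) * q i (s ω) * a i = a i := by
      rcases hsval ω i with hi | hi <;> simp [g, q, hi]
    simp [hone]
  · intro j _ hji
    have hindep : IndepFun (fun ω => g j (h ω)) (fun ω => q j (s ω)) P :=
      hhs.comp (hg j) (hq j)
    have hq_zero : ∫ ω, q j (s ω) ∂P = 0 := by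
      rw [(hspair i j hji.symm).integral_fun_mul_eq_mul_integral
          (hs_meas i).aestronglyMeasurable (hs_meas j).aestronglyMeasurable,
        integral_eq_zero_of_sign P (hs_meas i) (fun ω => hsval ω i) (hsunif i), zero_mul]
    rw [integral_mul_const, hindep.integral_fun_mul_eq_mul_integral
        ((hg j).comp hhm).aestronglyMeasurable ((hq j).comp hsm).aestronglyMeasurable,
      hq_zero, mul_zero, zero_mul]
  · simp
end

section
/- Variance bound for the count-sketch estimator (second part of Theorem 1): for every index i ∈ Fin n, Var[c_i] ≤ ‖a‖₂² / b, where ‖a‖₂ is the Euclidean norm of a. -/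
open MeasureTheory ProbabilityTheory
open scoped ENNReal

/-- If two independent random variables are uniform on `Fin b`, they collide with
probability `1 / b`. -/
theorem integral_collision_eq {Ω : Type*} [MeasurableSpace Ω] {P : Measure Ω}
    [IsProbabilityMeasure P] {b : ℕ} (hb : 1 ≤ b) {X Y : Ω → Fin b}
    (hX : Measurable X) (hY : Measurable Y)
    (hXu : ∀ x, P {ω | X ω = x} = 1 / (b : ℝ≥0∞))
    (hYu : ∀ x, P {ω | Y ω = x} = 1 / (b : ℝ≥0∞))
    (hXY : IndepFun X Y P) :
    ∫ ω, (if X ω = Y ω then (1 : ℝ) else 0) ∂P = 1 / b := by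
  have point (Z : Ω → Fin b) (hZ : Measurable Z)
      (hZu : ∀ x, P {ω | Z ω = x} = 1 / (b : ℝ≥0∞)) (x : Fin b) :
      ∫ ω, (if Z ω = x then (1 : ℝ) else 0) ∂P = 1 / b := by
    have hm : MeasurableSet {ω | Z ω = x} := hZ (measurableSet_singleton x)
    have := integral_indicator_one (μ := P) hm
    simp only [Set.indicator, Set.mem_ofPred_eq, Pi.one_apply] at this
    rw [this, measureReal_def, hZu]
    simp
  have hmeas (x : Fin b) : Measurable fun y : Fin b => if y = x then (1 : ℝ) else 0 :=
    Measurable.of_discrete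
  have split (ω : Ω) : (if X ω = Y ω then (1 : ℝ) else 0) =
      ∑ x, (if X ω = x then (1 : ℝ) else 0) * (if Y ω = x then (1 : ℝ) else 0) := by
    simp [eq_comm]
  simp_rw [split]
  rw [integral_finsetSum]
  · have key (x : Fin b) : ∫ ω, (if X ω = x then (1 : ℝ) else 0) *
        (if Y ω = x then (1 : ℝ) else 0) ∂P = 1 / b * (1 / b) := by
      rw [← point X hX hXu x]
      nth_rewrite 2 [point X hX hXu x]
      rw [← point Y hY hYu x]
      exact (hXY.comp (hmeas x) (hmeas x)).integral_fun_mul_eq_mul_integral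
        ((hmeas x).comp hX).aestronglyMeasurable ((hmeas x).comp hY).aestronglyMeasurable
    have hb' : (b : ℝ) ≠ 0 := by positivity
    simp only [key, Finset.sum_const, Finset.card_univ, Fintype.card_fin, nsmul_eq_mul]
    field_simp
  · intro x _
    refine Integrable.of_bound (((hmeas x).comp hX).mul
      ((hmeas x).comp hY)).aestronglyMeasurable 1 (ae_of_all _ fun ω => ?_)
    split_ifs <;> simp

/-- A random sign that is `1` with probability `1 / 2` is centered. -/
theorem integral_sign_eq_zero {Ω : Type*} [MeasurableSpace Ω] {P : Measure Ω}
    [IsProbabilityMeasure P] {X : Ω → ℝ} (hX : Measurable X)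
    (hval : ∀ ω, X ω = 1 ∨ X ω = -1) (hXu : P {ω | X ω = 1} = 1 / 2) :
    ∫ ω, X ω ∂P = 0 := by
  have hm : MeasurableSet {ω | X ω = 1} := hX (measurableSet_singleton 1)
  have split (ω : Ω) : X ω = 2 * {ω | X ω = 1}.indicator (1 : Ω → ℝ) ω - 1 := by
    rcases hval ω with hω | hω <;> simp [Set.indicator, hω] <;> norm_num
  rw [integral_congr_ae (ae_of_all _ split), integral_sub, integral_const_mul,
    integral_indicator_one hm, measureReal_def, hXu]
  · simp
  · exact ((integrable_const (1 : ℝ)).indicator hm).const_mul 2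
  · exact integrable_const 1

/-- Second moment of a randomly signed sum whose weights are bounded and independent of
pairwise uncorrelated signs. -/
theorem integral_sq_signed_sum {Ω ι κ : Type*} [MeasurableSpace Ω] {P : Measure Ω}
    [IsProbabilityMeasure P] [MeasurableSpace κ] {h : Ω → κ} {s : Ω → ι → ℝ}
    (hhm : Measurable h) (hsm : Measurable s) (hsval : ∀ ω i, s ω i = 1 ∨ s ω i = -1)
    (hcorr : ∀ i j, i ≠ j → ∫ ω, s ω i * s ω j ∂P = 0) (hhs : IndepFun h s P)
    (t : Finset ι) (a : ι → ℝ) (w : ι → κ → ℝ) (hw : ∀ j, Measurable (w j))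
    (hw01 : ∀ j y, w j y = 0 ∨ w j y = 1) :
    ∫ ω, (∑ j ∈ t, w j (h ω) * (s ω j * a j)) ^ 2 ∂P =
      ∑ j ∈ t, a j ^ 2 * ∫ ω, w j (h ω) ∂P := by
  have hwm (j k : ι) : Measurable fun y => w j y * w k y := (hw j).mul (hw k)
  have hsm' (j k : ι) : Measurable fun v : ι → ℝ => v j * v k :=
    (measurable_pi_apply j).mul (measurable_pi_apply k)
  have hint (j k : ι) : Integrable
      (fun ω => a j * a k * ((w j (h ω) * w k (h ω)) * (s ω j * s ω k))) P := by
    refine Integrable.const_mul (Integrable.of_bound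
      (((hwm j k).comp hhm).mul ((hsm' j k).comp hsm)).aestronglyMeasurable 1
      (ae_of_all _ fun ω => ?_)) _
    simp only [Pi.mul_apply, Function.comp_apply]
    rcases hw01 j (h ω) with h1 | h1 <;> rcases hw01 k (h ω) with h2 | h2 <;>
    rcases hsval ω j with h3 | h3 <;> rcases hsval ω k with h4 | h4 <;>
    simp [h1, h2, h3, h4]
  have expand (ω : Ω) : (∑ j ∈ t, w j (h ω) * (s ω j * a j)) ^ 2 =
      ∑ j ∈ t, ∑ k ∈ t, a j * a k * ((w j (h ω) * w k (h ω)) * (s ω j * s ω k)) := by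
    rw [sq, Finset.sum_mul_sum]
    exact Finset.sum_congr rfl fun j _ => Finset.sum_congr rfl fun k _ => by ring
  simp_rw [expand]
  rw [integral_finsetSum _ fun j _ => integrable_finsetSum _ fun k _ => hint j k]
  refine Finset.sum_congr rfl fun j hj => ?_
  rw [integral_finsetSum _ fun k _ => hint j k, Finset.sum_eq_single_of_mem j hj]
  · rw [integral_const_mul, sq]
    congr 1
    refine integral_congr_ae (ae_of_all _ fun ω => ?_)
    rcases hw01 j (h ω) with h1 | h1 <;> rcases hsval ω j with h3 | h3 <;> simp [h1, h3]
  · intro k _ hkj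
    rw [integral_const_mul]
    have := (hhs.comp (hwm j k) (hsm' j k)).integral_fun_mul_eq_mul_integral
      ((hwm j k).comp hhm).aestronglyMeasurable ((hsm' j k).comp hsm).aestronglyMeasurable
    simp only [Function.comp_apply] at this
    rw [this, hcorr j k hkj.symm, mul_zero, mul_zero]

/-- Variance bound for the count-sketch estimator (second part of Theorem 1):
for every index `i : Fin n`, `Var[c i] ≤ ‖a‖₂² / b`, where
`c i ω = s ω i * ∑_{j : h ω j = h ω i} s ω j * a j` and `‖a‖₂² = ∑ j, (a j)²`. -/
theorem countSketch_variance
    {Ω : Type*} [MeasurableSpace Ω] (P : Measure Ω) [IsProbabilityMeasure P]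
    {n b : ℕ} (hn : 1 ≤ n) (hb : 1 ≤ b) (a : Fin n → ℝ)
    (h : Ω → Fin n → Fin b) (s : Ω → Fin n → ℝ)
    (hhm : Measurable h) (hsm : Measurable s)
    (hsval : ∀ ω i, s ω i = 1 ∨ s ω i = -1)
    (hhunif : ∀ (i : Fin n) (x : Fin b), P {ω | h ω i = x} = 1 / (b : ℝ≥0∞))
    (hhpair : ∀ i j : Fin n, i ≠ j → IndepFun (fun ω => h ω i) (fun ω => h ω j) P)
    (hsunif : ∀ i : Fin n, P {ω | s ω i = 1} = 1 / 2)
    (hspair : ∀ i j : Fin n, i ≠ j → IndepFun (fun ω => s ω i) (fun ω => s ω j) P)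
    (hhs : IndepFun h s P)
    (c : Fin n → Ω → ℝ)
    (hc : ∀ i ω, c i ω =
      s ω i * ∑ j ∈ Finset.univ.filter (fun j => h ω j = h ω i), s ω j * a j)
    (i : Fin n) :
    variance (c i) P ≤ (∑ j, (a j) ^ 2) / (b : ℝ) := by
  have hhi (j : Fin n) : Measurable fun ω => h ω j := (measurable_pi_apply j).comp hhm
  have hsi (j : Fin n) : Measurable fun ω => s ω j := (measurable_pi_apply j).comp hsm
  have hcorr (j k : Fin n) (hjk : j ≠ k) : ∫ ω, s ω j * s ω k ∂P = 0 := by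
    rw [(hspair j k hjk).integral_fun_mul_eq_mul_integral (hsi j).aestronglyMeasurable
      (hsi k).aestronglyMeasurable,
      integral_sign_eq_zero (hsi j) (fun ω => hsval ω j) (hsunif j), zero_mul]
  let w (j : Fin n) (y : Fin n → Fin b) : ℝ := if y j = y i then 1 else 0
  have hw (j : Fin n) : Measurable (w j) := Measurable.of_discrete
  have hw01 (j : Fin n) (y : Fin n → Fin b) : w j y = 0 ∨ w j y = 1 := by
    by_cases hy : y j = y i <;> simp [w, hy]
  have hX := integral_sq_signed_sum hhm hsm hsval hcorr hhs (Finset.univ.erase i) a w hw hw01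
  have hcX (ω : Ω) : c i ω =
      s ω i * ∑ j ∈ Finset.univ.erase i, w j (h ω) * (s ω j * a j) + a i := by
    have hsum : ∑ j ∈ Finset.univ.filter (fun j => h ω j = h ω i), s ω j * a j =
        s ω i * a i + ∑ j ∈ Finset.univ.erase i, w j (h ω) * (s ω j * a j) := by
      rw [Finset.sum_filter, ← Finset.add_sum_erase _ _ (Finset.mem_univ i)]
      simp [w]
    rw [hc, hsum]
    rcases hsval ω i with hω | hω <;> rw [hω] <;> ring
  have hmeas : Measurable
      fun ω => s ω i * ∑ j ∈ Finset.univ.erase i, w j (h ω) * (s ω j * a j) :=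
    (hsi i).mul (Finset.measurable_fun_sum _ fun j _ =>
      ((hw j).comp hhm).mul ((hsi j).mul_const _))
  rw [funext hcX, variance_add_const hmeas.aestronglyMeasurable]
  refine (variance_le_expectation_sq hmeas.aestronglyMeasurable).trans ?_
  have hsq (ω : Ω) : (s ω i * ∑ j ∈ Finset.univ.erase i, w j (h ω) * (s ω j * a j)) ^ 2 =
      (∑ j ∈ Finset.univ.erase i, w j (h ω) * (s ω j * a j)) ^ 2 := by
    rcases hsval ω i with hω | hω <;> rw [hω] <;> ring
  simp only [Pi.pow_apply, hsq]
  rw [hX, Finset.sum_div]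
  refine (Finset.sum_le_sum fun j hj => ?_).trans
    (Finset.sum_le_sum_of_subset_of_nonneg (Finset.erase_subset i _)
      fun j _ _ => by positivity)
  rw [integral_collision_eq hb (hhi j) (hhi i) (hhunif j) (hhunif i)
    (hhpair j i (Finset.ne_of_mem_erase hj)), mul_one_div]
end

section
/- Per-estimator tail bound in terms of the residual ℓ₂-mass (key step toward Theorem 2): for any integer k ≥ 1 with b ≥ 1, any finite set S ⊆ Fin n of indices with |S| ≤ k, any index i ∈ Fin n, and any t > 0, the count-sketch estimator satisfies P[ |c_i − a_i| ≥ t ] ≤ k/b + (Σ_{j ∉ S, j ≠ i} a_j²) / (b·t²). -/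
open MeasureTheory ProbabilityTheory
open scoped ENNReal

section

variable {Ω : Type*} [MeasurableSpace Ω] {P : Measure Ω}

/-- Two independent uniform variables on `Fin b` collide with probability `1 / b`. -/
theorem measureReal_collision_of_uniform {b : ℕ} (hb : 1 ≤ b) {X Y : Ω → Fin b}
    (hX : Measurable X) (hY : Measurable Y)
    (hXu : ∀ x, P {ω | X ω = x} = 1 / (b : ℝ≥0∞)) (hYu : ∀ x, P {ω | Y ω = x} = 1 / (b : ℝ≥0∞))
    (hXY : IndepFun X Y P) : P.real {ω | X ω = Y ω} = 1 / b := by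
  have hunion : {ω | X ω = Y ω} = ⋃ x ∈ (Finset.univ : Finset (Fin b)),
      (X ⁻¹' {x} ∩ Y ⁻¹' {x}) := by
    ext ω
    simp [eq_comm]
  have hmeas : P {ω | X ω = Y ω} = 1 / (b : ℝ≥0∞) := by
    rw [hunion, measure_biUnion_finset]
    · have hterm : ∀ x, P (X ⁻¹' {x} ∩ Y ⁻¹' {x}) = 1 / (b : ℝ≥0∞) * (1 / b) := fun x => by
        rw [hXY.measure_inter_preimage_eq_mul _ _ (measurableSet_singleton x)
          (measurableSet_singleton x)]
        exact congrArg₂ _ (hXu x) (hYu x)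
      have hb0 : (b : ℝ≥0∞) ≠ 0 := by simp; omega
      simp only [hterm, Finset.sum_const, Finset.card_univ, Fintype.card_fin, nsmul_eq_mul,
        one_div]
      rw [← mul_assoc, ENNReal.mul_inv_cancel hb0 (ENNReal.natCast_ne_top b), one_mul]
    · intro x _ y _ hxy
      refine Set.disjoint_left.2 fun ω hx hy => hxy ?_
      exact hx.1.symm.trans hy.1
    · exact fun x _ => (hX (measurableSet_singleton x)).inter (hY (measurableSet_singleton x))
  simp [measureReal_def, hmeas]

/-- A uniform random sign has mean zero. -/
theorem integral_eq_zero_of_uniform_sign [IsProbabilityMeasure P] {σ : Ω → ℝ}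
    (hσ : Measurable σ) (hval : ∀ ω, σ ω = 1 ∨ σ ω = -1) (hu : P {ω | σ ω = 1} = 1 / 2) :
    ∫ ω, σ ω ∂P = 0 := by
  have hset : MeasurableSet {ω | σ ω = 1} := hσ (measurableSet_singleton 1)
  have heq : σ = fun ω => 2 * ({ω | σ ω = 1}.indicator 1 ω) - 1 := by
    funext ω
    rcases hval ω with h | h
    · simp [Set.indicator, h]; norm_num
    · simp [Set.indicator, h]; norm_num
  have hint : Integrable ({ω | σ ω = 1}.indicator (1 : Ω → ℝ)) P :=
    (integrable_const (1 : ℝ)).indicator hset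
  calc ∫ ω, σ ω ∂P = ∫ ω, (2 * ({ω | σ ω = 1}.indicator 1 ω) - 1 : ℝ) ∂P := by
        conv_lhs => rw [heq]
    _ = 2 * P.real {ω | σ ω = 1} - 1 := by
        rw [integral_sub (hint.const_mul 2) (integrable_const _), integral_const_mul,
          integral_indicator_one hset]
        simp
    _ = 0 := by simp [measureReal_def, hu]

/-- The second moment of a randomly signed sum of collision indicators, with pairwise
independent signs that are independent of the hash function. -/
theorem integral_signed_collision_sum_sq [IsProbabilityMeasure P] {n b : ℕ} (hb : 1 ≤ b)
    (a : Fin n → ℝ) (h : Ω → Fin n → Fin b) (s : Ω → Fin n → ℝ)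
    (hhm : Measurable h) (hsm : Measurable s)
    (hsval : ∀ ω i, s ω i = 1 ∨ s ω i = -1)
    (hhunif : ∀ (i : Fin n) (x : Fin b), P {ω | h ω i = x} = 1 / (b : ℝ≥0∞))
    (hhpair : ∀ i j : Fin n, i ≠ j → IndepFun (fun ω => h ω i) (fun ω => h ω j) P)
    (hsunif : ∀ i : Fin n, P {ω | s ω i = 1} = 1 / 2)
    (hspair : ∀ i j : Fin n, i ≠ j → IndepFun (fun ω => s ω i) (fun ω => s ω j) P)
    (hhs : IndepFun h s P) (i : Fin n) (T : Finset (Fin n)) (hT : i ∉ T) :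
    Integrable (fun ω => (∑ j ∈ T, (if h ω j = h ω i then s ω j * a j else 0)) ^ 2) P ∧
    ∫ ω, (∑ j ∈ T, (if h ω j = h ω i then s ω j * a j else 0)) ^ 2 ∂P
      = (∑ j ∈ T, a j ^ 2) / b := by
  have hhi : ∀ j, Measurable fun ω => h ω j := fun j => (measurable_pi_apply j).comp hhm
  have hsi : ∀ j, Measurable fun ω => s ω j := fun j => (measurable_pi_apply j).comp hsm
  let J : Fin n → Fin n → (Fin n → Fin b) → ℝ := fun j l g =>
    if g j = g i ∧ g l = g i then 1 else 0
  have hJ : ∀ j l, Measurable (J j l) := fun j l => measurable_of_countable _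
  let Q : Fin n → Fin n → (Fin n → ℝ) → ℝ := fun j l u => u j * u l
  have hQ : ∀ j l, Measurable (Q j l) := fun j l => by fun_prop
  have hexp : (fun ω => (∑ j ∈ T, (if h ω j = h ω i then s ω j * a j else 0)) ^ 2)
      = fun ω => ∑ j ∈ T, ∑ l ∈ T, J j l (h ω) * Q j l (s ω) * (a j * a l) := by
    funext ω
    rw [sq, Finset.sum_mul_sum]
    refine Finset.sum_congr rfl fun j _ => Finset.sum_congr rfl fun l _ => ?_
    by_cases h1 : h ω j = h ω i <;> by_cases h2 : h ω l = h ω i <;> simp [J, Q, h1, h2]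
    ring
  have habs : ∀ ω j, |s ω j| = 1 := fun ω j => by
    rcases hsval ω j with h1 | h1 <;> simp [h1]
  have hint : ∀ j l, Integrable (fun ω => J j l (h ω) * Q j l (s ω) * (a j * a l)) P := by
    intro j l
    refine Integrable.mul_const ?_ _
    refine Integrable.of_bound
      (((hJ j l).comp hhm).mul ((hQ j l).comp hsm)).aestronglyMeasurable 1 (.of_forall fun ω => ?_)
    simp only [J, Q, Real.norm_eq_abs, abs_mul, habs]
    split_ifs <;> simp
  have hval : ∀ j ∈ T, ∀ l ∈ T, ∫ ω, J j l (h ω) * Q j l (s ω) * (a j * a l) ∂P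
      = if j = l then a j ^ 2 / b else 0 := by
    intro j hj l _
    rw [integral_mul_const]
    split_ifs with hjl
    · subst hjl
      have hji : j ≠ i := fun e => hT (e ▸ hj)
      have hset : MeasurableSet {ω | h ω j = h ω i} := measurableSet_eq_fun (hhi j) (hhi i)
      have hfun : (fun ω => J j j (h ω) * Q j j (s ω)) = {ω | h ω j = h ω i}.indicator 1 := by
        funext ω
        have hsq : s ω j * s ω j = 1 := by rw [← abs_mul_abs_self, habs, one_mul]
        simp [J, Q, hsq, Set.indicator]
      rw [hfun, integral_indicator_one hset, measureReal_collision_of_uniform hb (hhi j) (hhi i)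
        (hhunif j) (hhunif i) (hhpair j i hji)]
      ring
    · have hind : IndepFun (fun ω => J j l (h ω)) (fun ω => Q j l (s ω)) P :=
        hhs.comp (hJ j l) (hQ j l)
      rw [hind.integral_fun_mul_eq_mul_integral
        ((hJ j l).comp hhm).aestronglyMeasurable ((hQ j l).comp hsm).aestronglyMeasurable]
      have hzero : ∫ ω, Q j l (s ω) ∂P = 0 := by
        rw [(hspair j l hjl).integral_fun_mul_eq_mul_integral
          (hsi j).aestronglyMeasurable (hsi l).aestronglyMeasurable,
          integral_eq_zero_of_uniform_sign (hsi j) (fun ω => hsval ω j) (hsunif j), zero_mul]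
      rw [hzero, mul_zero, zero_mul]
  rw [hexp]
  refine ⟨integrable_finsetSum _ fun j _ => integrable_finsetSum _ fun l _ => hint j l, ?_⟩
  rw [integral_finsetSum _ fun j _ => integrable_finsetSum _ fun l _ => hint j l,
    Finset.sum_div]
  refine Finset.sum_congr rfl fun j hj => ?_
  rw [integral_finsetSum _ fun l _ => hint j l, Finset.sum_congr rfl (hval j hj)]
  simp [hj]

end

/-- Per-estimator tail bound in terms of the residual ℓ₂-mass (key step toward Theorem 2):
for any `k ≥ 1` with `b ≥ 1`, any `S ⊆ Fin n` with `|S| ≤ k`, any index `i` and any `t > 0`,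
`P[ |c_i − a_i| ≥ t ] ≤ k/b + (∑_{j ∉ S, j ≠ i} a_j²)/(b·t²)`. -/
theorem countSketch_residual_tail
    {Ω : Type*} [MeasurableSpace Ω] (P : Measure Ω) [IsProbabilityMeasure P]
    {n b : ℕ} (hn : 1 ≤ n) (hb : 1 ≤ b) (a : Fin n → ℝ)
    (h : Ω → Fin n → Fin b) (s : Ω → Fin n → ℝ)
    (hhm : Measurable h) (hsm : Measurable s)
    (hsval : ∀ ω i, s ω i = 1 ∨ s ω i = -1)
    (hhunif : ∀ (i : Fin n) (x : Fin b), P {ω | h ω i = x} = 1 / (b : ℝ≥0∞))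
    (hhpair : ∀ i j : Fin n, i ≠ j → IndepFun (fun ω => h ω i) (fun ω => h ω j) P)
    (hsunif : ∀ i : Fin n, P {ω | s ω i = 1} = 1 / 2)
    (hspair : ∀ i j : Fin n, i ≠ j → IndepFun (fun ω => s ω i) (fun ω => s ω j) P)
    (hhs : IndepFun h s P)
    (c : Fin n → Ω → ℝ)
    (hc : ∀ i ω, c i ω =
      s ω i * ∑ j ∈ Finset.univ.filter (fun j => h ω j = h ω i), s ω j * a j)
    (k : ℕ) (hk : 1 ≤ k) (S : Finset (Fin n)) (hS : S.card ≤ k)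
    (i : Fin n) (t : ℝ) (ht : 0 < t) :
    P {ω | t ≤ |c i ω - a i|}
      ≤ ENNReal.ofReal ((k : ℝ) / b + (∑ j ∈ Sᶜ.erase i, (a j) ^ 2) / (b * t ^ 2)) := by
  have hhi : ∀ j, Measurable fun ω => h ω j := fun j => (measurable_pi_apply j).comp hhm
  have hb0 : (0 : ℝ) < b := by exact_mod_cast hb
  set T := Sᶜ.erase i with hTdef
  let X : Ω → ℝ := fun ω => ∑ j ∈ T, (if h ω j = h ω i then s ω j * a j else 0)
  obtain ⟨hXint, hXval⟩ := integral_signed_collision_sum_sq hb a h s hhm hsm hsval hhunif hhpair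
    hsunif hspair hhs i T (Finset.notMem_erase i _)
  have hmarkov : P.real {ω | t ^ 2 ≤ X ω ^ 2} ≤ (∑ j ∈ T, a j ^ 2) / (b * t ^ 2) := by
    have hm := mul_meas_ge_le_integral_of_nonneg (μ := P) (f := fun ω => X ω ^ 2)
      (.of_forall fun ω => sq_nonneg _) hXint (t ^ 2)
    rw [hXval] at hm
    rw [← div_div, le_div_iff₀ (by positivity), mul_comm]
    exact hm
  have hcollide : P.real (⋃ j ∈ S.erase i, {ω | h ω j = h ω i}) ≤ (k : ℝ) / b := by
    refine (measureReal_biUnion_finset_le _ _).trans ?_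
    rw [Finset.sum_congr rfl fun j hj => measureReal_collision_of_uniform hb (hhi j) (hhi i)
      (hhunif j) (hhunif i) (hhpair j i (Finset.ne_of_mem_erase hj))]
    rw [Finset.sum_const, nsmul_eq_mul, mul_one_div]
    gcongr
    exact (Finset.card_erase_le).trans hS
  have hsub : {ω | t ≤ |c i ω - a i|} ⊆
      (⋃ j ∈ S.erase i, {ω | h ω j = h ω i}) ∪ {ω | t ^ 2 ≤ X ω ^ 2} := by
    intro ω hω
    by_cases hE : ω ∈ ⋃ j ∈ S.erase i, {ω | h ω j = h ω i}
    · exact Or.inl hE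
    refine Or.inr ?_
    have hne : ∀ j ∈ S, j ≠ i → h ω j ≠ h ω i := by
      intro j hj hji hjE
      exact hE (Set.mem_biUnion (Finset.mem_erase.2 ⟨hji, hj⟩) hjE)
    have hX : X ω = ∑ j ∈ Finset.univ.erase i, (if h ω j = h ω i then s ω j * a j else 0) := by
      refine Finset.sum_subset (Finset.erase_subset_erase i (Finset.subset_univ _)) ?_
      intro j hj hjT
      have hji := Finset.ne_of_mem_erase hj
      have hjS : j ∈ S := by
        by_contra hjS
        exact hjT (Finset.mem_erase.2 ⟨hji, Finset.mem_compl.2 hjS⟩)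
      exact if_neg (hne j hjS hji)
    have herr : c i ω - a i = s ω i * X ω := by
      have hsq : s ω i * s ω i = 1 := by rcases hsval ω i with h1 | h1 <;> simp [h1]
      rw [hc, Finset.sum_filter, ← Finset.add_sum_erase _ _ (Finset.mem_univ i), ← hX, if_pos rfl]
      linear_combination a i * hsq
    have habs : |c i ω - a i| = |X ω| := by
      rw [herr, abs_mul]
      rcases hsval ω i with h1 | h1 <;> simp [h1]
    have hω' : t ≤ |X ω| := habs ▸ hω
    change t ^ 2 ≤ X ω ^ 2
    rw [← sq_abs (X ω)]
    gcongr
  rw [← ofReal_measureReal]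
  refine ENNReal.ofReal_le_ofReal ?_
  calc P.real {ω | t ≤ |c i ω - a i|}
      ≤ P.real ((⋃ j ∈ S.erase i, {ω | h ω j = h ω i}) ∪ {ω | t ^ 2 ≤ X ω ^ 2}) :=
        measureReal_mono hsub
    _ ≤ _ := (measureReal_union_le _ _).trans (add_le_add hcollide hmarkov)
end

section
/- Collision bound for the sum of two independent hashes: let h₁ : Ω → (Fin m → Fin b) and h₂ : Ω → (Fin n → Fin b) be independent random hash functions, each with coordinates uniform on Fin b and each family pairwise independent. Then for any pairs (i,j) ≠ (i′,j′) in Fin m × Fin n, the collision probability of the combined hash h(i,j) = h₁(i) + h₂(j) (summed as integers, taking values in {0,…,2b−2}) satisfies P[ h₁(i) + h₂(j) = h₁(i′) + h₂(j′) ] ≤ 1/b. -/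
open MeasureTheory ProbabilityTheory
open scoped ENNReal

/-- If `X` is independent of a finitely valued `Y` and `R X y` has probability at most `c` for
every fixed `y`, then `R X Y` has probability at most `c`. -/
theorem measure_rel_le_of_indepFun {Ω α β : Type*} [MeasurableSpace Ω] {P : Measure Ω}
    [IsProbabilityMeasure P] [MeasurableSpace α] [DiscreteMeasurableSpace α]
    [MeasurableSpace β] [MeasurableSingletonClass β] [Fintype β]
    {X : Ω → α} {Y : Ω → β} (hY : Measurable Y) (hXY : IndepFun X Y P)
    (R : α → β → Prop) {c : ℝ≥0∞} (hc : ∀ y, P {ω | R (X ω) y} ≤ c) :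
    P {ω | R (X ω) (Y ω)} ≤ c := by
  have hcover : {ω | R (X ω) (Y ω)} ⊆
      ⋃ y ∈ (Finset.univ : Finset β), X ⁻¹' {x | R x y} ∩ Y ⁻¹' {y} := by
    intro ω hω
    simpa using hω
  calc P {ω | R (X ω) (Y ω)}
      ≤ ∑ y, P (X ⁻¹' {x | R x y} ∩ Y ⁻¹' {y}) :=
        (measure_mono hcover).trans (measure_biUnion_finset_le _ _)
    _ = ∑ y, P (X ⁻¹' {x | R x y}) * P (Y ⁻¹' {y}) :=
        Finset.sum_congr rfl fun y _ =>
          hXY.measure_inter_preimage_eq_mul _ _ (MeasurableSet.of_discrete)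
            (measurableSet_singleton y)
    _ ≤ ∑ y, c * P (Y ⁻¹' {y}) :=
        Finset.sum_le_sum fun y _ => mul_le_mul_left (hc y) _
    _ = c := by
        rw [← Finset.mul_sum, sum_measure_preimage_singleton _
          fun y _ => hY (measurableSet_singleton y)]
        simp

/-- Shifted independent variables with values in `Fin b` collide with probability at most the
largest point mass of the first one. -/
theorem measure_add_eq_add_le_of_indepFun {Ω : Type*} [MeasurableSpace Ω] {P : Measure Ω}
    [IsProbabilityMeasure P] {b : ℕ} {X Y : Ω → Fin b} (hY : Measurable Y)
    (hXY : IndepFun X Y P) {c : ℝ≥0∞} (hX : ∀ x, P {ω | X ω = x} ≤ c) (k l : ℕ) :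
    P {ω | (X ω : ℕ) + k = (Y ω : ℕ) + l} ≤ c := by
  refine measure_rel_le_of_indepFun hY hXY (fun x y => (x : ℕ) + k = (y : ℕ) + l) fun y => ?_
  by_cases h : ∃ x : Fin b, (x : ℕ) + k = (y : ℕ) + l
  · obtain ⟨x, hx⟩ := h
    refine (measure_mono fun ω hω => ?_).trans (hX x)
    simp only [Set.mem_ofPred_eq, Fin.ext_iff] at hω ⊢
    omega
  · have hempty : {ω | (X ω : ℕ) + k = (y : ℕ) + l} = ∅ :=
      Set.eq_empty_of_forall_notMem fun ω hω => h ⟨X ω, hω⟩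
    simp [hempty]

/-- Collision bound for the sum of two independent hashes: if `h₁` and `h₂` are independent
random hash functions with uniform, pairwise independent coordinates, then for any pairs
`(i,j) ≠ (i',j')`, `P[ h₁(i) + h₂(j) = h₁(i') + h₂(j') ] ≤ 1/b` (hash values added as
integers). -/
theorem combined_hash_collision
    {Ω : Type*} [MeasurableSpace Ω] (P : Measure Ω) [IsProbabilityMeasure P]
    {m n b : ℕ} (hm : 1 ≤ m) (hn : 1 ≤ n) (hb : 1 ≤ b)
    (h₁ : Ω → Fin m → Fin b) (h₂ : Ω → Fin n → Fin b)
    (hm₁ : Measurable h₁) (hm₂ : Measurable h₂)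
    (hunif₁ : ∀ (i : Fin m) (x : Fin b), P {ω | h₁ ω i = x} = 1 / (b : ℝ≥0∞))
    (hunif₂ : ∀ (j : Fin n) (x : Fin b), P {ω | h₂ ω j = x} = 1 / (b : ℝ≥0∞))
    (hpair₁ : ∀ i i' : Fin m, i ≠ i' → IndepFun (fun ω => h₁ ω i) (fun ω => h₁ ω i') P)
    (hpair₂ : ∀ j j' : Fin n, j ≠ j' → IndepFun (fun ω => h₂ ω j) (fun ω => h₂ ω j') P)
    (hindep : IndepFun h₁ h₂ P)
    (i i' : Fin m) (j j' : Fin n) (hne : (i, j) ≠ (i', j')) :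
    P {ω | (h₁ ω i : ℕ) + (h₂ ω j : ℕ) = (h₁ ω i' : ℕ) + (h₂ ω j' : ℕ)}
      ≤ 1 / (b : ℝ≥0∞) := by
  by_cases hi : i = i'
  · have hj : j ≠ j' := fun hj => hne (Prod.ext hi hj)
    refine measure_rel_le_of_indepFun hm₁ hindep.symm
      (fun g f => (f i : ℕ) + (g j : ℕ) = (f i' : ℕ) + (g j' : ℕ)) fun f => ?_
    simpa only [add_comm] using
      measure_add_eq_add_le_of_indepFun (measurable_pi_iff.mp hm₂ j') (hpair₂ j j' hj)
        (fun x => (hunif₂ j x).le) (f i) (f i')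
  · exact measure_rel_le_of_indepFun hm₂ hindep
      (fun f g => (f i : ℕ) + (g j : ℕ) = (f i' : ℕ) + (g j' : ℕ)) fun g =>
        measure_add_eq_add_le_of_indepFun (measurable_pi_iff.mp hm₁ i') (hpair₁ i i' hi)
          (fun x => (hunif₁ i x).le) (g j) (g j')
end

section
/- Variance bound for the product count-sketch estimator of a matrix entry: for every (i,j) ∈ Fin m × Fin n, Var[ ĉ_{i,j} ] ≤ ‖M‖_F² / b, where ‖M‖_F = (Σ_{i,j} M_{i,j}²)^{1/2} is the Frobenius norm of M. -/
open MeasureTheory ProbabilityTheory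
open scoped ENNReal

namespace ProbabilityTheory

variable {Ω α β γ : Type*} [MeasurableSpace Ω] [MeasurableSpace α] [MeasurableSpace β]
  [MeasurableSpace γ] {P : Measure Ω} [IsProbabilityMeasure P]

/-- Independence is associative: a chain of independences can be rebracketed. -/
theorem IndepFun.prodMk_left_of_chain {X : Ω → α} {Y : Ω → β} {Z : Ω → γ}
    (hX : Measurable X) (hY : Measurable Y) (hZ : Measurable Z)
    (hXYZ : IndepFun X (fun ω => (Y ω, Z ω)) P) (hYZ : IndepFun Y Z P) :
    IndepFun (fun ω => (X ω, Y ω)) Z P := by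
  have := Measure.isProbabilityMeasure_map (μ := P) hX.aemeasurable
  have := Measure.isProbabilityMeasure_map (μ := P) hY.aemeasurable
  have := Measure.isProbabilityMeasure_map (μ := P) hZ.aemeasurable
  have hXY : IndepFun X Y P := hXYZ.comp measurable_id measurable_fst
  rw [indepFun_iff_map_prod_eq_prod_map_map (by fun_prop) (by fun_prop)] at hXYZ hYZ hXY ⊢
  rw [hXY, ← MeasurableEquiv.prodAssoc.map_measurableEquiv_injective.eq_iff,
    Measure.prodAssoc_prod, ← hYZ, ← hXYZ, Measure.map_map (by fun_prop) (by fun_prop)]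
  rfl

/-- If no value of `Y` has probability more than `p`, then `Y` hits an independent target with
probability at most `p`. -/
theorem IndepFun.measure_eq_le [MeasurableEq α] {X Y : Ω → α}
    (hX : Measurable X) (hY : Measurable Y) (hXY : IndepFun X Y P) {p : ℝ≥0∞}
    (hp : ∀ a, P {ω | Y ω = a} ≤ p) : P {ω | X ω = Y ω} ≤ p := by
  have := Measure.isProbabilityMeasure_map (μ := P) hX.aemeasurable
  have := Measure.isProbabilityMeasure_map (μ := P) hY.aemeasurable
  have hdiag : MeasurableSet (Set.diagonal α) := measurableSet_diagonal
  calc P {ω | X ω = Y ω} = P.map (fun ω => (X ω, Y ω)) (Set.diagonal α) := by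
        rw [Measure.map_apply (by fun_prop) hdiag]; rfl
    _ = ∫⁻ x, P.map Y (Prod.mk x ⁻¹' Set.diagonal α) ∂P.map X := by
        rw [(indepFun_iff_map_prod_eq_prod_map_map hX.aemeasurable hY.aemeasurable).1 hXY,
          Measure.prod_apply hdiag]
    _ ≤ ∫⁻ _, p ∂P.map X := by
        refine lintegral_mono fun x => ?_
        rw [Measure.map_apply hY (measurable_prodMk_left hdiag)]
        refine le_trans (measure_mono fun ω hω => ?_) (hp x)
        exact (Eq.symm hω : Y ω = x)
    _ = p := by simp

/-- A uniform random sign has mean zero. -/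
theorem integral_sign_eq_zero {s : Ω → ℝ} (hs : Measurable s) (hval : ∀ ω, s ω = 1 ∨ s ω = -1)
    (hunif : P {ω | s ω = 1} = 1 / 2) : ∫ ω, s ω ∂P = 0 := by
  have hset : MeasurableSet {ω | s ω = 1} := hs (measurableSet_singleton 1)
  have h : s = fun ω => 2 * {ω | s ω = 1}.indicator (1 : Ω → ℝ) ω - 1 := by
    funext ω
    rcases hval ω with h | h <;> norm_num [Set.indicator_apply, h]
  have hint : Integrable ({ω | s ω = 1}.indicator (1 : Ω → ℝ)) P :=
    (integrable_const (1 : ℝ)).indicator hset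
  rw [h, integral_sub (hint.const_mul 2) (integrable_const 1), integral_const_mul,
    integral_indicator_one hset]
  simp [Measure.real, hunif]

/-- Pairwise independent uniform random signs are orthonormal. -/
theorem integral_sign_mul_sign {ι : Type*} [DecidableEq ι] {s : Ω → ι → ℝ} (hs : Measurable s)
    (hval : ∀ ω i, s ω i = 1 ∨ s ω i = -1) (hunif : ∀ i, P {ω | s ω i = 1} = 1 / 2)
    (hpair : ∀ i i', i ≠ i' → IndepFun (fun ω => s ω i) (fun ω => s ω i') P) (i i' : ι) :
    ∫ ω, s ω i * s ω i' ∂P = if i = i' then 1 else 0 := by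
  split_ifs with h
  · subst h
    have h1 : ∀ ω, s ω i * s ω i = 1 := fun ω => by rcases hval ω i with h | h <;> simp [h]
    simp [h1]
  · rw [(hpair i i' h).integral_fun_mul_eq_mul_integral (by fun_prop) (by fun_prop),
      integral_sign_eq_zero (by fun_prop) (hval · i) (hunif i), zero_mul]

/-- Second moment of a linear combination of orthonormal bounded signs `σ`, weighted by bounded
coefficients `A` that are independent of them. -/
theorem integral_sq_sum_of_orthonormal {ι : Type*} [DecidableEq ι] {t : Finset ι}
    {σ A : ι → Ω → ℝ} {w : ι → ℝ} (hσ : ∀ q, Measurable (σ q)) (hA : ∀ q, Measurable (A q))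
    (hσ_le : ∀ q ω, |σ q ω| ≤ 1) (hA_le : ∀ q ω, |A q ω| ≤ 1)
    (hind : ∀ q r, IndepFun (fun ω => A q ω * A r ω) (fun ω => σ q ω * σ r ω) P)
    (horth : ∀ q r, ∫ ω, σ q ω * σ r ω ∂P = if q = r then 1 else 0) :
    ∫ ω, (∑ q ∈ t, σ q ω * A q ω * w q) ^ 2 ∂P = ∑ q ∈ t, w q ^ 2 * ∫ ω, A q ω ^ 2 ∂P := by
  have hint : ∀ q r, Integrable (fun ω => w q * w r * ((A q ω * A r ω) * (σ q ω * σ r ω))) P := by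
    intro q r
    refine (Integrable.of_bound (C := 1) ?_ (ae_of_all _ fun ω => ?_)).const_mul _
    · have := hσ q; have := hσ r; have := hA q; have := hA r
      fun_prop
    · simp only [Real.norm_eq_abs, abs_mul]
      exact mul_le_one₀ (mul_le_one₀ (hA_le q ω) (abs_nonneg _) (hA_le r ω)) (by positivity)
        (mul_le_one₀ (hσ_le q ω) (abs_nonneg _) (hσ_le r ω))
  have hexp : ∀ ω, (∑ q ∈ t, σ q ω * A q ω * w q) ^ 2
      = ∑ q ∈ t, ∑ r ∈ t, w q * w r * ((A q ω * A r ω) * (σ q ω * σ r ω)) := by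
    intro ω
    rw [sq, Finset.sum_mul_sum]
    exact Finset.sum_congr rfl fun q _ => Finset.sum_congr rfl fun r _ => by ring
  simp_rw [hexp]
  rw [integral_finsetSum _ fun q _ => integrable_finsetSum _ fun r _ => hint q r]
  refine Finset.sum_congr rfl fun q hq => ?_
  rw [integral_finsetSum _ fun r _ => hint q r]
  have hterm : ∀ r, ∫ ω, w q * w r * ((A q ω * A r ω) * (σ q ω * σ r ω)) ∂P
      = if q = r then w q ^ 2 * ∫ ω, A q ω ^ 2 ∂P else 0 := by
    intro r
    rw [integral_const_mul, (hind q r).integral_fun_mul_eq_mul_integral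
      ((hA q).mul (hA r)).aestronglyMeasurable ((hσ q).mul (hσ r)).aestronglyMeasurable, horth]
    split_ifs with h
    · subst h; simp [sq]
    · simp
  simp [hterm, hq]

/-- Two distinct index pairs collide under the sum of two independent, pairwise independent
uniform hash functions with probability at most `1 / b`. -/
theorem measure_hash_add_collision_le {m n b : ℕ}
    {h₁ : Ω → Fin m → Fin b} {h₂ : Ω → Fin n → Fin b} (hm₁ : Measurable h₁) (hm₂ : Measurable h₂)
    (hunif₁ : ∀ (i : Fin m) (x : Fin b), P {ω | h₁ ω i = x} = 1 / (b : ℝ≥0∞))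
    (hunif₂ : ∀ (j : Fin n) (x : Fin b), P {ω | h₂ ω j = x} = 1 / (b : ℝ≥0∞))
    (hpair₁ : ∀ i i' : Fin m, i ≠ i' → IndepFun (fun ω => h₁ ω i) (fun ω => h₁ ω i') P)
    (hpair₂ : ∀ j j' : Fin n, j ≠ j' → IndepFun (fun ω => h₂ ω j) (fun ω => h₂ ω j') P)
    (hind : IndepFun h₁ h₂ P) {q r : Fin m × Fin n} (hqr : q ≠ r) :
    P {ω | (h₁ ω q.1 : ℕ) + (h₂ ω q.2 : ℕ) = (h₁ ω r.1 : ℕ) + (h₂ ω r.2 : ℕ)}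
      ≤ 1 / (b : ℝ≥0∞) := by
  obtain ⟨i', j'⟩ := q
  obtain ⟨i, j⟩ := r
  by_cases hj : j' = j
  · subst hj
    have hi : i ≠ i' := fun h => hqr (by rw [h])
    refine le_trans (measure_mono fun ω hω => ?_) ((hpair₁ i i' hi).measure_eq_le
      (by fun_prop) (by fun_prop) fun x => (hunif₁ i' x).le)
    simp only [Set.mem_ofPred_eq, Nat.add_right_cancel_iff] at hω
    exact (Fin.ext hω).symm
  · have hchain : IndepFun (fun ω => (h₁ ω, h₂ ω j)) (fun ω => h₂ ω j') P :=
      IndepFun.prodMk_left_of_chain hm₁ (by fun_prop) (by fun_prop)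
        (hind.comp measurable_id (ψ := fun h : Fin n → Fin b => (h j, h j')) (by fun_prop))
        (hpair₂ j j' (Ne.symm hj))
    have hφ : Measurable (fun x : (Fin m → Fin b) × Fin b =>
      ((x.1 i : ℕ) : ℤ) + (x.2 : ℕ) - (x.1 i' : ℕ)) := measurable_of_countable _
    have hψ : Measurable (fun y : Fin b => ((y : ℕ) : ℤ)) := measurable_of_countable _
    refine le_trans (measure_mono fun ω hω => ?_) ((hchain.comp hφ hψ).measure_eq_le
      (hφ.comp (by fun_prop)) (hψ.comp (by fun_prop)) fun a => ?_)
    · simp only [Set.mem_ofPred_eq, Function.comp_apply] at hω ⊢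
      omega
    · rcases Set.eq_empty_or_nonempty {ω | (((h₂ ω j' : ℕ) : ℤ)) = a} with he | ⟨ω₀, hω₀⟩
      · simp [he]
      · refine le_trans (measure_mono fun ω hω => ?_) (hunif₂ j' (h₂ ω₀ j')).le
        simp only [Set.mem_ofPred_eq, Function.comp_apply] at hω hω₀ ⊢
        exact Fin.ext (by omega)

end ProbabilityTheory

/-- Variance bound for the product count-sketch estimator of a matrix entry:
for every `(i,j)`, `Var[ ĉ i j ] ≤ ‖M‖_F² / b`, where
`ĉ i j ω = s₁(i)s₂(j) · ∑_{(i',j') : h₁(i')+h₂(j') = h₁(i)+h₂(j)} s₁(i')s₂(j') M i' j'`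
(hash values added as integers). Mutual independence of the quadruple `(h₁,h₂,s₁,s₂)`
is expressed by the chain conditions `hmut₁`, `hmut₂`, `hmut₃`. -/
theorem product_countSketch_variance
    {Ω : Type*} [MeasurableSpace Ω] (P : Measure Ω) [IsProbabilityMeasure P]
    {m n b : ℕ} (hm : 1 ≤ m) (hn : 1 ≤ n) (hb : 1 ≤ b)
    (M : Matrix (Fin m) (Fin n) ℝ)
    (h₁ : Ω → Fin m → Fin b) (h₂ : Ω → Fin n → Fin b)
    (s₁ : Ω → Fin m → ℝ) (s₂ : Ω → Fin n → ℝ)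
    (hm₁ : Measurable h₁) (hm₂ : Measurable h₂) (hm₃ : Measurable s₁) (hm₄ : Measurable s₂)
    (hval₁ : ∀ ω i, s₁ ω i = 1 ∨ s₁ ω i = -1)
    (hval₂ : ∀ ω j, s₂ ω j = 1 ∨ s₂ ω j = -1)
    (hhunif₁ : ∀ (i : Fin m) (x : Fin b), P {ω | h₁ ω i = x} = 1 / (b : ℝ≥0∞))
    (hhunif₂ : ∀ (j : Fin n) (x : Fin b), P {ω | h₂ ω j = x} = 1 / (b : ℝ≥0∞))
    (hhpair₁ : ∀ i i' : Fin m, i ≠ i' → IndepFun (fun ω => h₁ ω i) (fun ω => h₁ ω i') P)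
    (hhpair₂ : ∀ j j' : Fin n, j ≠ j' → IndepFun (fun ω => h₂ ω j) (fun ω => h₂ ω j') P)
    (hsunif₁ : ∀ i : Fin m, P {ω | s₁ ω i = 1} = 1 / 2)
    (hsunif₂ : ∀ j : Fin n, P {ω | s₂ ω j = 1} = 1 / 2)
    (hspair₁ : ∀ i i' : Fin m, i ≠ i' → IndepFun (fun ω => s₁ ω i) (fun ω => s₁ ω i') P)
    (hspair₂ : ∀ j j' : Fin n, j ≠ j' → IndepFun (fun ω => s₂ ω j) (fun ω => s₂ ω j') P)
    (hmut₁ : IndepFun h₁ (fun ω => (h₂ ω, s₁ ω, s₂ ω)) P)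
    (hmut₂ : IndepFun h₂ (fun ω => (s₁ ω, s₂ ω)) P)
    (hmut₃ : IndepFun s₁ s₂ P)
    (c : Fin m → Fin n → Ω → ℝ)
    (hc : ∀ i j ω, c i j ω = s₁ ω i * s₂ ω j *
      ∑ q ∈ Finset.univ.filter (fun q : Fin m × Fin n =>
          (h₁ ω q.1 : ℕ) + (h₂ ω q.2 : ℕ) = (h₁ ω i : ℕ) + (h₂ ω j : ℕ)),
        s₁ ω q.1 * s₂ ω q.2 * M q.1 q.2)
    (i : Fin m) (j : Fin n) :
    variance (c i j) P ≤ (∑ i', ∑ j', (M i' j') ^ 2) / (b : ℝ) := by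
  classical
  let σ : Fin m × Fin n → Ω → ℝ := fun q ω => s₁ ω q.1 * s₂ ω q.2
  let coll : Fin m × Fin n → (Fin m → Fin b) × (Fin n → Fin b) → ℝ := fun q h =>
    if (h.1 q.1 : ℕ) + (h.2 q.2 : ℕ) = (h.1 i : ℕ) + (h.2 j : ℕ) then 1 else 0
  let A : Fin m × Fin n → Ω → ℝ := fun q ω => coll q (h₁ ω, h₂ ω)
  have hcoll : ∀ q, Measurable (coll q) := fun q => measurable_of_countable _
  have hσm : ∀ q, Measurable (σ q) := fun q => by fun_prop
  have hAm : ∀ q, Measurable (A q) := fun q => (hcoll q).comp (hm₁.prodMk hm₂)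
  have hσsq : ∀ q ω, σ q ω ^ 2 = 1 := fun q ω => by
    rcases hval₁ ω q.1 with h | h <;> rcases hval₂ ω q.2 with h' | h' <;> simp [σ, h, h']
  have hσ_le : ∀ q ω, |σ q ω| ≤ 1 := fun q ω => by
    rw [← sq_le_one_iff_abs_le_one, hσsq]
  have hA_le : ∀ q ω, |A q ω| ≤ 1 := fun q ω => by
    simp only [A, coll]; split_ifs <;> simp
  have hhs : IndepFun (fun ω => (h₁ ω, h₂ ω)) (fun ω => (s₁ ω, s₂ ω)) P :=
    IndepFun.prodMk_left_of_chain hm₁ hm₂ (by fun_prop) hmut₁ hmut₂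
  have hind : ∀ q r, IndepFun (fun ω => A q ω * A r ω) (fun ω => σ q ω * σ r ω) P := fun q r =>
    hhs.comp (φ := fun h : (Fin m → Fin b) × (Fin n → Fin b) => coll q h * coll r h)
      (ψ := fun s : (Fin m → ℝ) × (Fin n → ℝ) => s.1 q.1 * s.2 q.2 * (s.1 r.1 * s.2 r.2))
      ((hcoll q).mul (hcoll r)) (by fun_prop)
  have horth : ∀ q r, ∫ ω, σ q ω * σ r ω ∂P = if q = r then 1 else 0 := by
    intro q r
    have hprod : ∀ ω, σ q ω * σ r ω = (s₁ ω q.1 * s₁ ω r.1) * (s₂ ω q.2 * s₂ ω r.2) :=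
      fun ω => mul_mul_mul_comm _ _ _ _
    have hss : IndepFun (fun ω => s₁ ω q.1 * s₁ ω r.1) (fun ω => s₂ ω q.2 * s₂ ω r.2) P :=
      hmut₃.comp (φ := fun s : Fin m → ℝ => s q.1 * s r.1)
        (ψ := fun s : Fin n → ℝ => s q.2 * s r.2)
        (by fun_prop) (by fun_prop)
    simp_rw [hprod]
    rw [hss.integral_fun_mul_eq_mul_integral (by fun_prop) (by fun_prop),
      integral_sign_mul_sign hm₃ hval₁ hsunif₁ hspair₁,
      integral_sign_mul_sign hm₄ hval₂ hsunif₂ hspair₂]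
    split_ifs <;> simp_all [Prod.ext_iff]
  have hprob : ∀ q ∈ Finset.univ.erase (i, j), ∫ ω, A q ω ^ 2 ∂P ≤ 1 / b := by
    intro q hq
    have hset : MeasurableSet
        {ω | (h₁ ω q.1 : ℕ) + (h₂ ω q.2 : ℕ) = (h₁ ω i : ℕ) + (h₂ ω j : ℕ)} := by
      have : MeasurableSet {h : (Fin m → Fin b) × (Fin n → Fin b) |
          (h.1 q.1 : ℕ) + (h.2 q.2 : ℕ) = (h.1 i : ℕ) + (h.2 j : ℕ)} :=
        (Set.toFinite _).measurableSet
      exact (hm₁.prodMk hm₂) this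
    have hA : (fun ω => A q ω ^ 2) = Set.indicator
        {ω | (h₁ ω q.1 : ℕ) + (h₂ ω q.2 : ℕ) = (h₁ ω i : ℕ) + (h₂ ω j : ℕ)} 1 := by
      funext ω
      simp [A, coll, Set.indicator_apply]
    rw [hA, integral_indicator_one hset]
    have := measure_hash_add_collision_le hm₁ hm₂ hhunif₁ hhunif₂ hhpair₁ hhpair₂
      (hmut₁.comp measurable_id measurable_fst) (Finset.ne_of_mem_erase hq)
    have hb0 : (b : ℝ≥0∞) ≠ 0 := by exact_mod_cast (by omega : b ≠ 0)
    simpa [Measure.real] using ENNReal.toReal_mono (by simp [hb0]) this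
  have herr : ∀ ω, c i j ω - M i j =
      σ (i, j) ω * ∑ q ∈ Finset.univ.erase (i, j), σ q ω * A q ω * M q.1 q.2 := by
    intro ω
    have hsum : c i j ω = σ (i, j) ω * ∑ q, σ q ω * A q ω * M q.1 q.2 := by
      rw [hc, Finset.sum_filter]
      congr 1
      refine Finset.sum_congr rfl fun q _ => ?_
      simp [σ, A, coll]
    have hA : A (i, j) ω = 1 := by simp [A, coll]
    rw [hsum, ← Finset.add_sum_erase _ _ (Finset.mem_univ (i, j)), hA]
    linear_combination M i j * hσsq (i, j) ω
  have hcm : AEStronglyMeasurable (c i j) P := by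
    have : c i j = fun ω =>
        σ (i, j) ω * (∑ q ∈ Finset.univ.erase (i, j), σ q ω * A q ω * M q.1 q.2) + M i j :=
      funext fun ω => by rw [← herr, sub_add_cancel]
    rw [this]
    fun_prop
  calc variance (c i j) P = variance (fun ω => c i j ω - M i j) P :=
        (variance_sub_const hcm _).symm
    _ ≤ ∫ ω, (c i j ω - M i j) ^ 2 ∂P :=
        variance_le_expectation_sq (hcm.sub aestronglyMeasurable_const)
    _ = ∫ ω, (∑ q ∈ Finset.univ.erase (i, j), σ q ω * A q ω * M q.1 q.2) ^ 2 ∂P := by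
        simp_rw [herr, mul_pow, hσsq, one_mul]
    _ = ∑ q ∈ Finset.univ.erase (i, j), M q.1 q.2 ^ 2 * ∫ ω, A q ω ^ 2 ∂P :=
        integral_sq_sum_of_orthonormal hσm hAm hσ_le hA_le hind horth
    _ ≤ ∑ q ∈ Finset.univ.erase (i, j), M q.1 q.2 ^ 2 * (1 / b) :=
        Finset.sum_le_sum fun q hq => mul_le_mul_of_nonneg_left (hprob q hq) (sq_nonneg _)
    _ ≤ ∑ q : Fin m × Fin n, M q.1 q.2 ^ 2 * (1 / b) :=
        Finset.sum_le_sum_of_subset_of_nonneg (Finset.erase_subset _ _) fun _ _ _ => by positivity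
    _ = (∑ i', ∑ j', (M i' j') ^ 2) / (b : ℝ) := by
        rw [← Finset.sum_mul, Fintype.sum_prod_type, mul_one_div]
end
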